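/- arXiv:1307.0771 — 11 statements merged into one kernel-verified Lean document; each statement's English description precedes it below -/
import Mathlib

section
/- Let p ∈ (0,1], let k ∈ ℕ, and let s₁, …, s_k and s be real numbers satisfying 0 ≤ s_i ≤ (2i+1)² for each 1 ≤ i ≤ k and 0 ≤ s ≤ (2k+1)². Then ∑_{i=1}^{k} p·(1−p)^{i−1}·s_i + (1−p)^k·s ≤ 1 + 8/p². -/
theorem history_sum_eq (p : ℝ) (hp0 : 0 < p) (k : ℕ) :
    (∑ i ∈ Finset.Icc 1 k, p * (1 - p) ^ (i - 1) * (2 * (i : ℝ) + 1) ^ 2)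
      + (1 - p) ^ k * (2 * (k : ℝ) + 1) ^ 2 + (1 - p) ^ k * (8 * (k / p + 1 / p ^ 2))
      = 1 + 8 / p ^ 2 := by
  induction k with
  | zero => simp; ring
  | succ k ih =>
    rw [Finset.sum_Icc_succ_top (by omega), ← ih]
    simp only [Nat.add_sub_cancel, pow_succ (1 - p) k]
    push_cast
    field_simp
    ring

/-- Analytic core of Theorem 1, bound (14): history expansion under partial
depolarizing noise, each history weight bounded by Zalka's bound. -/
theorem stmt0 (p : ℝ) (hp0 : 0 < p) (hp1 : p ≤ 1) (k : ℕ)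
    (s : ℕ → ℝ) (sl : ℝ)
    (hs : ∀ i ∈ Finset.Icc 1 k, 0 ≤ s i ∧ s i ≤ (2 * (i : ℝ) + 1) ^ 2)
    (hsl0 : 0 ≤ sl) (hsl : sl ≤ (2 * (k : ℝ) + 1) ^ 2) :
    (∑ i ∈ Finset.Icc 1 k, p * (1 - p) ^ (i - 1) * s i) + (1 - p) ^ k * sl
      ≤ 1 + 8 / p ^ 2 := by
  have hq : 0 ≤ 1 - p := by linarith
  have h1 : (∑ i ∈ Finset.Icc 1 k, p * (1 - p) ^ (i - 1) * s i) ≤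
      ∑ i ∈ Finset.Icc 1 k, p * (1 - p) ^ (i - 1) * (2 * (i : ℝ) + 1) ^ 2 :=
    Finset.sum_le_sum fun i hi =>
      mul_le_mul_of_nonneg_left (hs i hi).2 (mul_nonneg hp0.le (pow_nonneg hq _))
  have h2 := mul_le_mul_of_nonneg_left hsl (pow_nonneg hq k)
  have h3 : 0 ≤ (1 - p) ^ k * (8 * (k / p + 1 / p ^ 2)) :=
    mul_nonneg (pow_nonneg hq k) (by positivity)
  have h4 := history_sum_eq p hp0 k
  linarith
end

section
/- Let p ∈ (0,1], let k ∈ ℕ, and let s₁, …, s_k and s be real numbers satisfying 0 ≤ s_i ≤ (2i+1)² for each 1 ≤ i ≤ k and 0 ≤ s ≤ (2k+1)². Then ∑_{i=1}^{k} p·(1−p)^{i−1}·s_i + (1−p)^k·s ≤ 8·(k+1)/p. -/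
theorem aux1 (p : ℝ) (hp0 : 0 < p) (hp1 : p ≤ 1) (k : ℕ) :
    p * ((∑ i ∈ Finset.Icc 1 k, p * (1 - p) ^ (i - 1) * (2 * (i : ℝ) + 1) ^ 2)
      + (1 - p) ^ k * (2 * (k : ℝ) + 1) ^ 2) ≤ p + 8 * k * (1 - (1 - p) ^ k) := by
  induction k with
  | zero => simp
  | succ k ih =>
    rw [Finset.sum_Icc_succ_top (by omega)]
    have h : (1 - p) ^ k ≤ 1 := pow_le_one₀ (by linarith) (by linarith)
    simp only [Nat.add_sub_cancel, pow_succ (1 - p) k]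
    push_cast
    generalize (1 - p) ^ k = q at *
    nlinarith

/-- Analytic core of Theorem 1, bound (15). -/
theorem stmt1 (p : ℝ) (hp0 : 0 < p) (hp1 : p ≤ 1) (k : ℕ)
    (s : ℕ → ℝ) (sl : ℝ)
    (hs : ∀ i ∈ Finset.Icc 1 k, 0 ≤ s i ∧ s i ≤ (2 * (i : ℝ) + 1) ^ 2)
    (hsl0 : 0 ≤ sl) (hsl : sl ≤ (2 * (k : ℝ) + 1) ^ 2) :
    (∑ i ∈ Finset.Icc 1 k, p * (1 - p) ^ (i - 1) * s i) + (1 - p) ^ k * sl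
      ≤ 8 * ((k : ℝ) + 1) / p := by
  have hq : 0 ≤ 1 - p := by linarith
  have h1 : (∑ i ∈ Finset.Icc 1 k, p * (1 - p) ^ (i - 1) * s i) + (1 - p) ^ k * sl ≤
      (∑ i ∈ Finset.Icc 1 k, p * (1 - p) ^ (i - 1) * (2 * (i : ℝ) + 1) ^ 2)
      + (1 - p) ^ k * (2 * (k : ℝ) + 1) ^ 2 := by
    apply add_le_add
    · apply Finset.sum_le_sum
      intro i hi
      exact mul_le_mul_of_nonneg_left (hs i hi).2 (by positivity)
    · exact mul_le_mul_of_nonneg_left hsl (by positivity)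
  refine h1.trans ?_
  rw [le_div_iff₀ hp0, mul_comm]
  refine (aux1 p hp0 hp1 k).trans ?_
  have h2 : 0 ≤ (k : ℝ) * (1 - p) ^ k := by positivity
  nlinarith
end

section
/- Let x and y be real numbers with 0 ≤ x ≤ 1 and 0 ≤ y ≤ 1, and let α be a real number with 0 < α < ∞. Then √(x·y) + √((1−x)·(1−y)) ≤ 1 + (1/2)·(α−1)·x + (1/2)·(1/α − 1)·y. -/
/-- Lemma 5 ('xyineq') of the paper. -/
theorem stmt4 (x y α : ℝ) (hx0 : 0 ≤ x) (hx1 : x ≤ 1) (hy0 : 0 ≤ y) (hy1 : y ≤ 1)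
    (hα : 0 < α) :
    Real.sqrt (x * y) + Real.sqrt ((1 - x) * (1 - y))
      ≤ 1 + (1 / 2) * (α - 1) * x + (1 / 2) * (1 / α - 1) * y := by
  have amgm : ∀ a b : ℝ, 0 ≤ a → 0 ≤ b → Real.sqrt (a * b) ≤ (a + b) / 2 := by
    intro a b ha hb
    rw [Real.sqrt_le_iff]
    exact ⟨by linarith, by nlinarith [sq_nonneg (a - b)]⟩
  have h1 := amgm (α * x) (1 / α * y) (by positivity) (by positivity)
  have h2 := amgm (1 - x) (1 - y) (by linarith) (by linarith)
  have e : α * x * (1 / α * y) = x * y := by field_simp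
  rw [e] at h1
  linarith
end

section
/- Let N ≥ 1 be a natural number, k ∈ ℕ, and let x be a real number with 0 ≤ x ≤ 1. If 2N − 2·√N·√x − 2·√N·√(N−1)·√(1−x) ≤ 4k², then N·x ≤ (2k+1)². -/
/-- Explicit form (12) of Zalka's implicit bound (11). -/
theorem stmt5 (N : ℕ) (hN : 1 ≤ N) (k : ℕ) (x : ℝ) (hx0 : 0 ≤ x) (hx1 : x ≤ 1)
    (h : 2 * (N : ℝ) - 2 * Real.sqrt N * Real.sqrt x
          - 2 * Real.sqrt N * Real.sqrt ((N : ℝ) - 1) * Real.sqrt (1 - x)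
        ≤ 4 * (k : ℝ) ^ 2) :
    (N : ℝ) * x ≤ (2 * (k : ℝ) + 1) ^ 2 := by
  have hN' : (1 : ℝ) ≤ N := by exact_mod_cast hN
  have hk : (0 : ℝ) ≤ k := Nat.cast_nonneg k
  have a := Real.sq_sqrt (show (0 : ℝ) ≤ N by linarith)
  have b := Real.sq_sqrt (show (0 : ℝ) ≤ (N : ℝ) - 1 by linarith)
  have c := Real.sq_sqrt (show (0 : ℝ) ≤ 1 - x by linarith)
  have d := Real.sq_sqrt hx0
  have hs0 : 0 ≤ Real.sqrt N * Real.sqrt x := by positivity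
  have hs : (Real.sqrt N * Real.sqrt x) ^ 2 = N * x := by rw [mul_pow, a, d]
  have ht : (Real.sqrt N * Real.sqrt (1 - x)) ^ 2 = N * (1 - x) := by rw [mul_pow, a, c]
  have amgm := sq_nonneg (Real.sqrt ((N : ℝ) - 1) - Real.sqrt N * Real.sqrt (1 - x))
  have key : (Real.sqrt N * Real.sqrt x - 1) ^ 2 ≤ (2 * (k : ℝ)) ^ 2 := by
    nlinarith
  have h1 : Real.sqrt N * Real.sqrt x - 1 ≤ 2 * (k : ℝ) :=
    (abs_le_of_sq_le_sq' key (by linarith)).2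
  rw [← hs]
  exact pow_le_pow_left₀ hs0 (by linarith) 2
end

section
/- For all real numbers p and ε with 0 < p < 1 and 0 < ε < 1, the following two inequalities hold: 1/(1 + 1/(p·log(1/ε))) ≤ min{1−ε, p·log(1/ε)} and min{1−ε, p·log(1/ε)} ≤ 2/(1 + 1/(p·log(1/ε))). -/
/-- Lemma 6 ('memoryoptimaliylemma') of the paper. -/
theorem stmt6 (p ε : ℝ) (hp0 : 0 < p) (hp1 : p < 1) (hε0 : 0 < ε) (hε1 : ε < 1) :
    1 / (1 + 1 / (p * Real.log (1 / ε))) ≤ min (1 - ε) (p * Real.log (1 / ε))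
      ∧ min (1 - ε) (p * Real.log (1 / ε)) ≤ 2 / (1 + 1 / (p * Real.log (1 / ε))) := by
  have hL : 0 < Real.log (1 / ε) := Real.log_pos (by rw [lt_div_iff₀ hε0]; linarith)
  have hL2 : Real.log (1 / ε) ≤ 1 / ε - 1 := Real.log_le_sub_one_of_pos (by positivity)
  have hx : 0 < p * Real.log (1 / ε) := mul_pos hp0 hL
  have hx2 : p * Real.log (1 / ε) ≤ 1 / ε - 1 := by nlinarith
  generalize p * Real.log (1 / ε) = x at hx hx2 ⊢
  have hk : ε * (1 + x) ≤ 1 := by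
    have h : 1 + x ≤ 1 / ε := by linarith
    rw [le_div_iff₀ hε0] at h
    linarith
  have e1 : 1 / (1 + 1 / x) = x / (1 + x) := by field_simp; ring
  have e2 : 2 / (1 + 1 / x) = 2 * x / (1 + x) := by field_simp; ring
  have h1 : 0 < 1 + x := by linarith
  rw [e1, e2]
  refine ⟨le_min ?_ ?_, ?_⟩
  · rw [div_le_iff₀ h1]; nlinarith
  · rw [div_le_iff₀ h1]; nlinarith
  · rcases le_total x 1 with h | h
    · refine (min_le_right _ _).trans ?_
      rw [le_div_iff₀ h1]; nlinarith
    · refine (min_le_left _ _).trans ?_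
      rw [le_div_iff₀ h1]; nlinarith
end

section
/- Let p ∈ (0,1], let N be a natural number with N > 9/p², let m ≥ 1, and for i = 1, …, m let k_i ∈ ℕ and ε_i ∈ (0,1) satisfy 1 − ε_i ≤ 9/(N·p²) and 1 − ε_i ≤ 8·(k_i+1)/(N·p). Set ε := ∏_{i=1}^{m} ε_i and q := ∑_{i=1}^{m} (k_i+1). Then q ≥ (N·p·log(1/ε)/8) · [ −(N·p²/9)·log(1 − 9/(N·p²)) ]^{−1}. -/
/-- Finite-N lower runtime bound (equation (25)) of Theorem 2. -/
theorem stmt7 (p : ℝ) (hp0 : 0 < p) (hp1 : p ≤ 1) (N : ℕ) (hN : 9 / p ^ 2 < (N : ℝ))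
    (m : ℕ) (hm : 1 ≤ m) (k : ℕ → ℕ) (ε : ℕ → ℝ)
    (hε : ∀ i ∈ Finset.Icc 1 m, 0 < ε i ∧ ε i < 1)
    (h1 : ∀ i ∈ Finset.Icc 1 m, 1 - ε i ≤ 9 / ((N : ℝ) * p ^ 2))
    (h2 : ∀ i ∈ Finset.Icc 1 m, 1 - ε i ≤ 8 * ((k i : ℝ) + 1) / ((N : ℝ) * p)) :
    ((N : ℝ) * p * Real.log (1 / ∏ i ∈ Finset.Icc 1 m, ε i) / 8) *
        (-((N : ℝ) * p ^ 2 / 9) * Real.log (1 - 9 / ((N : ℝ) * p ^ 2)))⁻¹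
      ≤ ∑ i ∈ Finset.Icc 1 m, ((k i : ℝ) + 1) := by
  have hp2 : 0 < p ^ 2 := by positivity
  have hNpos : (0 : ℝ) < N := lt_trans (by positivity) hN
  have hNp : 0 < (N : ℝ) * p := by positivity
  have hNp2 : 0 < (N : ℝ) * p ^ 2 := by positivity
  have hxi : (N : ℝ) * p ^ 2 / 9 = (9 / ((N : ℝ) * p ^ 2))⁻¹ := by rw [inv_div]
  rw [hxi]
  have hx1 : 9 / ((N : ℝ) * p ^ 2) < 1 := by
    rw [div_lt_one hNp2]
    exact (div_lt_iff₀ hp2).1 hN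
  have hx0 : 0 < 9 / ((N : ℝ) * p ^ 2) := by positivity
  generalize 9 / ((N : ℝ) * p ^ 2) = x at *
  have hlog : Real.log (1 - x) < 0 := Real.log_neg (by linarith) (by linarith)
  have hC : 0 < -x⁻¹ * Real.log (1 - x) :=
    mul_pos_of_neg_of_neg (neg_neg_of_pos (inv_pos.2 hx0)) hlog
  have key : ∀ i ∈ Finset.Icc 1 m, -Real.log (ε i) ≤ (-x⁻¹ * Real.log (1 - x)) * (1 - ε i) := by
    intro i hi
    obtain ⟨he0, he1⟩ := hε i hi
    have hd := h1 i hi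
    have hdx : (1 - ε i) / x ≤ 1 := (div_le_one hx0).2 hd
    have hm1 : (1 - x) ∈ Set.Ioi (0 : ℝ) := by
      simp only [Set.mem_Ioi]
      linarith
    have hm2 : (1 : ℝ) ∈ Set.Ioi (0 : ℝ) := by simp
    have ha : 0 ≤ (1 - ε i) / x := div_nonneg (by linarith) hx0.le
    have hb : 0 ≤ 1 - (1 - ε i) / x := by linarith
    have hc := strictConcaveOn_log_Ioi.concaveOn.2 hm1 hm2 ha hb (by ring)
    simp only [smul_eq_mul, Real.log_one, mul_zero, add_zero] at hc
    have he : (1 - ε i) / x * (1 - x) + (1 - (1 - ε i) / x) * 1 = ε i := by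
      field_simp
      ring
    rw [he] at hc
    have : (-x⁻¹ * Real.log (1 - x)) * (1 - ε i) = -((1 - ε i) / x * Real.log (1 - x)) := by
      ring
    linarith
  generalize -x⁻¹ * Real.log (1 - x) = C at *
  have hl : Real.log (1 / ∏ i ∈ Finset.Icc 1 m, ε i) = ∑ i ∈ Finset.Icc 1 m, -Real.log (ε i) := by
    rw [one_div, Real.log_inv, Real.log_prod (fun i hi => (hε i hi).1.ne'),
      Finset.sum_neg_distrib]
  rw [hl, ← div_eq_mul_inv, div_le_iff₀ hC, Finset.mul_sum, Finset.sum_div, Finset.sum_mul]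
  refine Finset.sum_le_sum fun i hi => ?_
  have h3 := (le_div_iff₀ hNp).1 (h2 i hi)
  have h4 := mul_le_mul_of_nonneg_left (key i hi) hNp.le
  have h5 := mul_le_mul_of_nonneg_left h3 hC.le
  linarith
end

section
/- Fix p ∈ (0,1]. For each natural number N ≥ 1, let m_N ≥ 1, and for i = 1, …, m_N let k_N^i ∈ ℕ and ε_N^i ∈ (0,1) satisfy 1 − ε_N^i ≤ (1/N)·(1 + 8/p²) and 1 − ε_N^i ≤ 8·(k_N^i+1)/(N·p). Set ε_N := ∏_{i=1}^{m_N} ε_N^i and q_N := ∑_{i=1}^{m_N} (k_N^i + 1). Then liminf_{N→∞} q_N/(N·log(1/ε_N)) ≥ p/8. -/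
/-- Asymptotic lower runtime bound (equation (24)) of Theorem 2. -/
theorem stmt8 (p : ℝ) (hp0 : 0 < p) (hp1 : p ≤ 1)
    (m : ℕ → ℕ) (k : ℕ → ℕ → ℕ) (ε : ℕ → ℕ → ℝ)
    (hm : ∀ N, 1 ≤ N → 1 ≤ m N)
    (hε : ∀ N, 1 ≤ N → ∀ i ∈ Finset.Icc 1 (m N), 0 < ε N i ∧ ε N i < 1)
    (h1 : ∀ N, 1 ≤ N → ∀ i ∈ Finset.Icc 1 (m N),
      1 - ε N i ≤ (1 / (N : ℝ)) * (1 + 8 / p ^ 2))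
    (h2 : ∀ N, 1 ≤ N → ∀ i ∈ Finset.Icc 1 (m N),
      1 - ε N i ≤ 8 * ((k N i : ℝ) + 1) / ((N : ℝ) * p)) :
    ((p / 8 : ℝ) : EReal) ≤ Filter.liminf (fun N : ℕ =>
      (((∑ i ∈ Finset.Icc 1 (m N), ((k N i : ℝ) + 1)) /
          ((N : ℝ) * Real.log (1 / ∏ i ∈ Finset.Icc 1 (m N), ε N i)) : ℝ) : EReal))
      Filter.atTop := by
  have hlim : Filter.Tendsto (fun N : ℕ => p / 8 * (1 - (1 / (N : ℝ)) * (1 + 8 / p ^ 2)))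
      Filter.atTop (nhds (p / 8)) := by
    have h := (((tendsto_one_div_atTop_nhds_zero_nat (𝕜 := ℝ)).mul_const
      (1 + 8 / p ^ 2)).const_sub 1).const_mul (p / 8)
    simpa using h
  have hlimE : Filter.Tendsto
      (fun N : ℕ => ((p / 8 * (1 - (1 / (N : ℝ)) * (1 + 8 / p ^ 2)) : ℝ) : EReal))
      Filter.atTop (nhds ((p / 8 : ℝ) : EReal)) :=
    (continuous_coe_real_ereal.tendsto _).comp hlim
  rw [← hlimE.liminf_eq]
  refine Filter.liminf_le_liminf ?_
  have hpos : ∀ᶠ N : ℕ in Filter.atTop,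
      0 < p / 8 * (1 - (1 / (N : ℝ)) * (1 + 8 / p ^ 2)) :=
    hlim.eventually (lt_mem_nhds (by positivity))
  filter_upwards [hpos, Filter.eventually_ge_atTop 1] with N hN hN1
  rw [EReal.coe_le_coe_iff]
  have hNr : (0 : ℝ) < N := by exact_mod_cast hN1
  set d : ℝ := 1 - (1 / (N : ℝ)) * (1 + 8 / p ^ 2) with hd
  have hdpos : 0 < d := pos_of_mul_pos_right hN (by positivity)
  have hlog : Real.log (1 / ∏ i ∈ Finset.Icc 1 (m N), ε N i)
      = ∑ i ∈ Finset.Icc 1 (m N), - Real.log (ε N i) := by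
    rw [one_div, Real.log_inv, Real.log_prod (fun i hi => (hε N hN1 i hi).1.ne'),
      Finset.sum_neg_distrib]
  have hne : (Finset.Icc 1 (m N)).Nonempty := Finset.nonempty_Icc.mpr (hm N hN1)
  have hLpos : 0 < ∑ i ∈ Finset.Icc 1 (m N), - Real.log (ε N i) := by
    refine Finset.sum_pos (fun i hi => ?_) hne
    have := Real.log_neg (hε N hN1 i hi).1 (hε N hN1 i hi).2
    linarith
  rw [hlog, le_div_iff₀ (by positivity), ← mul_assoc, Finset.mul_sum]
  refine Finset.sum_le_sum (fun i hi => ?_)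
  obtain ⟨h0, hlt⟩ := hε N hN1 i hi
  have a1 := h1 N hN1 i hi
  have a2 := h2 N hN1 i hi
  rw [le_div_iff₀ (by positivity)] at a2
  have hde : d ≤ ε N i := by rw [hd]; linarith
  have hl : - Real.log (ε N i) ≤ (ε N i)⁻¹ - 1 := by
    have := Real.one_sub_inv_le_log_of_pos h0
    linarith
  have hl0 : 0 ≤ - Real.log (ε N i) := by
    have := Real.log_neg h0 hlt
    linarith
  have hdl : d * - Real.log (ε N i) ≤ 1 - ε N i := by
    calc d * - Real.log (ε N i) ≤ ε N i * - Real.log (ε N i) :=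
          mul_le_mul_of_nonneg_right hde hl0
      _ ≤ ε N i * ((ε N i)⁻¹ - 1) := mul_le_mul_of_nonneg_left hl h0.le
      _ = 1 - ε N i := by field_simp
  calc p / 8 * d * N * - Real.log (ε N i)
      = (N * p) / 8 * (d * - Real.log (ε N i)) := by ring
    _ ≤ (N * p) / 8 * (1 - ε N i) := mul_le_mul_of_nonneg_left hdl (by positivity)
    _ ≤ (k N i : ℝ) + 1 := by linarith
end

section
/- Let N be a natural number, let p, ε ∈ (0,1), let r ∈ ℕ, and for g = 0, 1, …, r let k_g ∈ ℕ and s_g ∈ [0,1] satisfy s_g ≤ (1 + 8/p²)/(N−g) and s_g ≤ 8·(k_g+1)/(p·(N−g)). Set q := ∑_{g=0}^{r} (k_g+1) and assume q ≤ N and N − q > 1 + 8/p². If ∏_{g=0}^{r} (1 − s_g) ≤ ε, then q ≥ N/(1 + 8·C/(p·log(1/ε))), where C := (1 − (1 + 8/p²)/(N−q))^{−1}. -/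
/-- Theorem 5 of the paper (lower runtime bound on exclusion algorithms). -/
theorem stmt9 (N : ℕ) (p ε : ℝ) (hp0 : 0 < p) (hp1 : p < 1) (hε0 : 0 < ε) (hε1 : ε < 1)
    (r : ℕ) (k : ℕ → ℕ) (s : ℕ → ℝ)
    (hs01 : ∀ g ∈ Finset.range (r + 1), 0 ≤ s g ∧ s g ≤ 1)
    (hsa : ∀ g ∈ Finset.range (r + 1), s g ≤ (1 + 8 / p ^ 2) / ((N : ℝ) - g))
    (hsb : ∀ g ∈ Finset.range (r + 1), s g ≤ 8 * ((k g : ℝ) + 1) / (p * ((N : ℝ) - g)))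
    (q : ℝ) (hq : q = ∑ g ∈ Finset.range (r + 1), ((k g : ℝ) + 1))
    (hqN : q ≤ (N : ℝ)) (hNq : 1 + 8 / p ^ 2 < (N : ℝ) - q)
    (hfail : ∏ g ∈ Finset.range (r + 1), (1 - s g) ≤ ε) :
    (N : ℝ) / (1 + 8 * (1 - (1 + 8 / p ^ 2) / ((N : ℝ) - q))⁻¹ / (p * Real.log (1 / ε)))
      ≤ q := by
  set a : ℝ := 1 + 8 / p ^ 2 with ha
  have ha1 : 0 < a := by positivity
  set M : ℝ := (N : ℝ) - q with hM
  have hM0 : 0 < M := by linarith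
  have haM : a / M < 1 := (div_lt_one hM0).2 hNq
  have hd : 0 < 1 - a / M := by linarith
  set C : ℝ := (1 - a / M)⁻¹ with hC
  have hC0 : 0 < C := inv_pos.2 hd
  have hL : 0 < Real.log (1 / ε) := Real.log_pos (by rw [lt_div_iff₀ hε0]; linarith)
  set L : ℝ := Real.log (1 / ε) with hLdef
  have hrq : (r : ℝ) + 1 ≤ q := by
    rw [hq, Finset.sum_add_distrib]
    have : (0 : ℝ) ≤ ∑ g ∈ Finset.range (r + 1), (k g : ℝ) :=
      Finset.sum_nonneg (fun _ _ => Nat.cast_nonneg _)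
    simp
    linarith
  have hNg : ∀ g ∈ Finset.range (r + 1), M ≤ (N : ℝ) - g := by
    intro g hg
    have h1 : (g : ℝ) < (r : ℝ) + 1 := by exact_mod_cast Finset.mem_range.1 hg
    linarith
  have hsM : ∀ g ∈ Finset.range (r + 1), s g ≤ a / M := by
    intro g hg
    exact (hsa g hg).trans (div_le_div_of_nonneg_left ha1.le hM0 (hNg g hg))
  have hterm : ∀ g ∈ Finset.range (r + 1),
      -Real.log (1 - s g) ≤ 8 * C / (p * M) * ((k g : ℝ) + 1) := by
    intro g hg
    have h1 := hsM g hg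
    have h0 := (hs01 g hg).1
    have hpos : 0 < 1 - s g := by linarith
    have hlog := Real.one_sub_inv_le_log_of_pos hpos
    have hinv : (1 - s g)⁻¹ ≤ C := inv_anti₀ hd (by linarith)
    have he : (1 - s g)⁻¹ - 1 = s g * (1 - s g)⁻¹ := by field_simp; ring
    have hb : s g ≤ 8 * ((k g : ℝ) + 1) / (p * M) :=
      (hsb g hg).trans (div_le_div_of_nonneg_left (by positivity) (by positivity)
        (mul_le_mul_of_nonneg_left (hNg g hg) hp0.le))
    calc -Real.log (1 - s g) ≤ s g * (1 - s g)⁻¹ := by linarith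
      _ ≤ s g * C := mul_le_mul_of_nonneg_left hinv h0
      _ ≤ 8 * ((k g : ℝ) + 1) / (p * M) * C := mul_le_mul_of_nonneg_right hb hC0.le
      _ = _ := by ring
  have hpos : ∀ g ∈ Finset.range (r + 1), 0 < 1 - s g := by
    intro g hg
    have := hsM g hg
    linarith
  have hlogp : L ≤ 8 * C / (p * M) * q := by
    have h1 := Real.log_le_log (Finset.prod_pos hpos) hfail
    rw [Real.log_prod (fun g hg => (hpos g hg).ne')] at h1
    have h2 := Finset.sum_le_sum hterm
    rw [← Finset.mul_sum, ← hq, Finset.sum_neg_distrib] at h2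
    have h3 : L = -Real.log ε := by rw [hLdef, one_div, Real.log_inv]
    linarith
  have hfin : M ≤ q * (8 * C / (p * L)) := by
    have h1 : 8 * C / (p * M) * q = 8 * C * q / (p * M) := by ring
    rw [h1, le_div_iff₀ (by positivity)] at hlogp
    have h2 : q * (8 * C / (p * L)) = 8 * C * q / (p * L) := by ring
    rw [h2, le_div_iff₀ (by positivity)]
    linarith
  rw [div_le_iff₀ (by positivity)]
  linarith
end

section
/- Let N ≥ 100 be a natural number, let ε ∈ (0, 1/2], let p ∈ [0,1], and set c := 10. For g ∈ ℕ define α_g := (1 + g/(c·log(1/ε)))^{−1/2} and k_g := ⌊α_g·(π/4)·√N⌋. Then there exists g* ∈ ℕ such that ∑_{g=0}^{g*} (k_g+1) ≤ 100·(N·p + √N)·log(1/ε) and ∏_{g=0}^{g*} (1 − (1−p)^{k_g}·sin²((2k_g+1)·arcsin(1/√N))) ≤ ε. -/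
lemma aux_sum (M : ℝ) (hM : 1 ≤ M) (n : ℕ) :
    ∑ g ∈ Finset.range (n + 1), (Real.sqrt (1 + (g : ℝ) / M))⁻¹
      ≤ 2 * M * Real.sqrt (1 + (n : ℝ) / M) := by
  have hM0 : 0 < M := by linarith
  induction n with
  | zero => simp; linarith
  | succ n ih =>
    rw [Finset.sum_range_succ]
    have hb0 : 0 ≤ (n : ℝ) / M := by positivity
    have hab : (1 + ((n + 1 : ℕ) : ℝ) / M) = 1 + (n : ℝ) / M + 1 / M := by
      push_cast; ring
    have hM1 : 0 < 1 / M := by positivity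
    set a := Real.sqrt (1 + ((n + 1 : ℕ) : ℝ) / M) with ha
    set b := Real.sqrt (1 + (n : ℝ) / M) with hb
    have ha2 : a ^ 2 = 1 + (n : ℝ) / M + 1 / M := by
      rw [ha, hab]; exact Real.sq_sqrt (by positivity)
    have hb2 : b ^ 2 = 1 + (n : ℝ) / M := Real.sq_sqrt (by positivity)
    have hapos : 0 < a := by rw [ha, hab]; exact Real.sqrt_pos.mpr (by positivity)
    have hdiff : M * (a ^ 2 - b ^ 2) = 1 := by
      rw [ha2, hb2]; field_simp; ring
    have key : a⁻¹ ≤ 2 * M * a - 2 * M * b := by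
      rw [inv_le_iff_one_le_mul₀ hapos]
      nlinarith [mul_nonneg hM0.le (sq_nonneg (a - b))]
    linarith

set_option maxHeartbeats 1000000 in
lemma aux_q (N : ℕ) (hN : 100 ≤ N) (p : ℝ) (hp0 : 0 ≤ p) (hp1 : p ≤ 1) (u : ℝ)
    (hu : 5 / 4 ≤ u) (hu2 : 5 / 2 * p ^ 2 * N ≤ u) (k : ℕ)
    (hk : k = ⌊(Real.sqrt u)⁻¹ * (Real.pi / 4) * Real.sqrt N⌋₊) :
    9 / 32 / u ≤ (1 - p) ^ k *
            Real.sin ((2 * (k : ℝ) + 1) * Real.arcsin (1 / Real.sqrt N)) ^ 2 := by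
  have hu0 : 0 < u := by linarith
  have hNr : (100 : ℝ) ≤ N := by exact_mod_cast hN
  have hNpos : (0 : ℝ) < N := by linarith
  have hpi1 := Real.pi_gt_d2
  have hpi2 := Real.pi_lt_d2
  set r := Real.sqrt N with hr
  have hr2 : r ^ 2 = N := Real.sq_sqrt hNpos.le
  have hr10 : 10 ≤ r := Real.le_sqrt_of_sq_le (by linarith)
  have hr0 : 0 < r := by linarith
  set y := (Real.sqrt u)⁻¹ * (Real.pi / 4) * r with hy
  have hy0 : 0 ≤ y := by positivity
  have hy2 : y ^ 2 = Real.pi ^ 2 / 16 * N / u := by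
    rw [hy, mul_pow, mul_pow, inv_pow, Real.sq_sqrt hu0.le, hr2]; field_simp; norm_num
  have hky : (k : ℝ) ≤ y := by rw [hk]; exact Nat.floor_le hy0
  have hyk : y < k + 1 := by rw [hk]; exact Nat.lt_floor_add_one y
  have hx0 : 0 < 1 / r := by positivity
  have hx1 : 1 / r ≤ 1 / 10 := one_div_le_one_div_of_le (by norm_num) hr10
  have hx2 : (1 / r) ^ 2 = 1 / N := by rw [div_pow, hr2]; norm_num
  have hrx : r * (1 / r) = 1 := by field_simp
  set x := 1 / r with hx
  set θ := Real.arcsin x with hθ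
  have hsθ : Real.sin θ = x := Real.sin_arcsin (by linarith) (by linarith)
  have hθ0 : 0 ≤ θ := Real.arcsin_nonneg.mpr hx0.le
  have hθx : x ≤ θ := by rw [← hsθ]; exact Real.sin_le hθ0
  have hθu : θ ≤ 1.03 * x := by
    rw [hθ, Real.arcsin_le_iff_le_sin ⟨by linarith, by linarith⟩ ⟨by linarith, by linarith⟩]
    have h := Real.sin_gt_sub_cube (x := 1.03 * x) (by linarith)
    have h3 : x ^ 3 ≤ x / 100 := by
      have : x ^ 2 ≤ 1 / 100 := by nlinarith
      nlinarith
    norm_num at h ⊢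
    nlinarith
  by_cases hk0 : k = 0
  · rw [hk0]
    simp only [pow_zero, Nat.cast_zero, mul_zero, zero_add, one_mul]
    rw [hsθ, hx2]
    have hy1 : y ^ 2 < 1 := by
      rw [hk0] at hyk
      norm_num at hyk
      nlinarith
    rw [hy2, div_lt_one hu0] at hy1
    rw [div_le_div_iff₀ hu0 hNpos]
    have h9 : 9 / 32 ≤ Real.pi ^ 2 / 16 := by nlinarith
    have := mul_le_mul_of_nonneg_right h9 hNpos.le
    linarith
  · have hk1 : (1 : ℝ) ≤ k := by exact_mod_cast Nat.one_le_iff_ne_zero.mpr hk0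
    have hpow : 1 / 2 ≤ (1 - p) ^ k := by
      have hB := one_add_mul_le_pow (a := -p) (by linarith) k
      have hyp : y * p ≤ 1 / 2 := by
        refine (abs_le_of_sq_le_sq' ?_ (by norm_num)).2
        rw [mul_pow, hy2]
        have : Real.pi ^ 2 / 16 * N / u * p ^ 2 = (Real.pi ^ 2 / 40) * ((5 / 2 * p ^ 2 * N) / u) := by
          ring
        rw [this]
        have h1 : (5 / 2 * p ^ 2 * N) / u ≤ 1 := (div_le_one hu0).mpr hu2
        have h2 : Real.pi ^ 2 / 40 ≤ 1 / 4 := by nlinarith only [hpi1, hpi2]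
        have h3 := mul_le_mul h2 h1 (by positivity) (by norm_num)
        norm_num at h3 ⊢
        linarith only [h3]
      have hkp : k * p ≤ 1 / 2 := le_trans (mul_le_mul_of_nonneg_right hky hp0) hyp
      have e : 1 + -p = 1 - p := by ring
      rw [e] at hB
      linarith only [hB, hkp]
    have hylin : y ≤ 0.7055 * r := by
      have hs : (Real.sqrt u)⁻¹ ≤ 0.8945 := by
        have : (1.118 : ℝ) ≤ Real.sqrt u := Real.le_sqrt_of_sq_le (by norm_num; linarith)
        calc (Real.sqrt u)⁻¹ ≤ (1.118)⁻¹ := inv_anti₀ (by norm_num) this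
          _ ≤ _ := by norm_num
      have : (Real.sqrt u)⁻¹ * (Real.pi / 4) ≤ 0.7055 := by
        calc (Real.sqrt u)⁻¹ * (Real.pi / 4) ≤ 0.8945 * (3.15 / 4) := by gcongr
          _ ≤ 0.7055 := by norm_num
      exact mul_le_mul_of_nonneg_right this hr0.le
    have hang : (2 * (k : ℝ) + 1) * θ ≤ Real.pi / 2 := by
      have h1 : 2 * (k : ℝ) + 1 ≤ 1.5115 * r := by linarith
      calc _ ≤ (1.5115 * r) * (1.03 * x) := by gcongr
        _ = 1.5115 * 1.03 * (r * x) := by ring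
        _ ≤ _ := by rw [hrx]; norm_num; linarith
    have hsin := Real.mul_le_sin (x := (2 * (k : ℝ) + 1) * θ) (by positivity) hang
    have hlow : 2 / Real.pi * (3 / 2 * y * x) ≤ Real.sin ((2 * (k : ℝ) + 1) * θ) := by
      refine le_trans ?_ hsin
      have : 3 / 2 * y ≤ 2 * (k : ℝ) + 1 := by linarith
      gcongr
    have hsq : (2 / Real.pi * (3 / 2 * y * x)) ^ 2 ≤ Real.sin ((2 * (k : ℝ) + 1) * θ) ^ 2 :=
      pow_le_pow_left₀ (by positivity) hlow 2
    have heq : (2 / Real.pi * (3 / 2 * y * x)) ^ 2 = 9 / 16 / u := by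
      rw [mul_pow, mul_pow, mul_pow, hy2, hx2]
      field_simp
      norm_num
    rw [heq] at hsq
    calc 9 / 32 / u = 1 / 2 * (9 / 16 / u) := by ring
      _ ≤ _ := by gcongr

/-- Analytic content of Theorem 3 (fault-ignorance of Algorithm 1). -/
theorem stmt10 (N : ℕ) (hN : 100 ≤ N) (ε : ℝ) (hε0 : 0 < ε) (hε1 : ε ≤ 1 / 2)
    (p : ℝ) (hp0 : 0 ≤ p) (hp1 : p ≤ 1) (c : ℝ) (hc : c = 10)
    (k : ℕ → ℕ)
    (hk : ∀ g : ℕ, k g = ⌊(Real.sqrt (1 + (g : ℝ) / (c * Real.log (1 / ε))))⁻¹ *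
        (Real.pi / 4) * Real.sqrt N⌋₊) :
    ∃ gs : ℕ,
      (∑ g ∈ Finset.range (gs + 1), ((k g : ℝ) + 1))
          ≤ 100 * ((N : ℝ) * p + Real.sqrt N) * Real.log (1 / ε) ∧
      (∏ g ∈ Finset.range (gs + 1),
          (1 - (1 - p) ^ (k g) *
            Real.sin ((2 * (k g : ℝ) + 1) * Real.arcsin (1 / Real.sqrt N)) ^ 2)) ≤ ε := by
  subst hc
  have hL : 0.693 ≤ Real.log (1 / ε) := by
    have h2 := Real.log_two_gt_d9
    have : Real.log 2 ≤ Real.log (1 / ε) := by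
      apply Real.log_le_log (by norm_num)
      rw [le_div_iff₀ hε0]; linarith
    linarith
  have hεL : Real.exp (-Real.log (1 / ε)) = ε := by
    rw [one_div, Real.log_inv, neg_neg, Real.exp_log hε0]
  set L := Real.log (1 / ε) with hLdef
  have hNr : (100 : ℝ) ≤ N := by exact_mod_cast hN
  have hNpos : (0 : ℝ) < N := by linarith
  have hr2 : Real.sqrt N ^ 2 = N := Real.sq_sqrt hNpos.le
  have hr10 : 10 ≤ Real.sqrt N := Real.le_sqrt_of_sq_le (by linarith)
  obtain ⟨M, hM⟩ : ∃ M, M = 10 * L := ⟨_, rfl⟩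
  rw [← hM] at hk
  have hM1 : 6.93 ≤ M := by linarith
  have hM0 : 0 < M := by linarith
  obtain ⟨u0, hu0⟩ : ∃ u0 : ℝ, u0 = 5 / 4 + 5 / 2 * p ^ 2 * N := ⟨_, rfl⟩
  have hpN : 0 ≤ p ^ 2 * N := by positivity
  have hu0' : 5 / 4 ≤ u0 := by linarith
  obtain ⟨u1, hu1⟩ : ∃ u1 : ℝ, u1 = 7 / 4 * u0 := ⟨_, rfl⟩
  have hgs0 : 0 ≤ M * (u1 - 1) := mul_nonneg hM0.le (by linarith)
  obtain ⟨gs, hgs⟩ : ∃ gs, gs = ⌊M * (u1 - 1)⌋₊ := ⟨_, rfl⟩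
  obtain ⟨A, hA⟩ : ∃ A, A = ⌈M * (u0 - 1)⌉₊ := ⟨_, rfl⟩
  have hgsle : (gs : ℝ) ≤ M * (u1 - 1) := by rw [hgs]; exact Nat.floor_le hgs0
  have hgslt : M * (u1 - 1) < gs + 1 := by rw [hgs]; exact Nat.lt_floor_add_one _
  have hAle : M * (u0 - 1) ≤ A := by rw [hA]; exact Nat.le_ceil _
  have hAlt : (A : ℝ) < M * (u0 - 1) + 1 := by
    rw [hA]; exact Nat.ceil_lt_add_one (mul_nonneg hM0.le (by linarith))
  refine ⟨gs, ?_, ?_⟩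
  · have hsum : ∑ g ∈ Finset.range (gs + 1), ((k g : ℝ) + 1)
        ≤ (∑ g ∈ Finset.range (gs + 1), (Real.sqrt (1 + (g : ℝ) / M))⁻¹)
            * ((Real.pi / 4) * Real.sqrt N) + (gs + 1) := by
      rw [Finset.sum_add_distrib, Finset.sum_mul]
      have h1 : ∑ g ∈ Finset.range (gs + 1), (1 : ℝ) = gs + 1 := by simp
      rw [h1]
      gcongr with g hg
      rw [hk g, ← mul_assoc]
      exact Nat.floor_le (by positivity)
    have h2 := aux_sum M (by linarith) gs
    have h3 : Real.sqrt (1 + (gs : ℝ) / M) ≤ 1.5 + 2.1 * (p * Real.sqrt N) := by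
      apply Real.sqrt_le_iff.mpr
      refine ⟨by positivity, ?_⟩
      have : (gs : ℝ) / M ≤ u1 - 1 := by rw [div_le_iff₀ hM0]; linarith
      have e : (1.5 + 2.1 * (p * Real.sqrt N)) ^ 2
          = 2.25 + 6.3 * (p * Real.sqrt N) + 4.41 * (p ^ 2 * N) := by
        linear_combination 4.41 * p ^ 2 * hr2
      rw [e]
      have : 0 ≤ p * Real.sqrt N := by positivity
      norm_num
      linarith
    have hpi2 := Real.pi_lt_d2
    have h4 : (∑ g ∈ Finset.range (gs + 1), (Real.sqrt (1 + (g : ℝ) / M))⁻¹)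
            * ((Real.pi / 4) * Real.sqrt N)
        ≤ (2 * M * (1.5 + 2.1 * (p * Real.sqrt N))) * ((3.15 / 4) * Real.sqrt N) := by
      refine mul_le_mul (h2.trans ?_) ?_ (by positivity) (by positivity)
      · gcongr
      · gcongr
    have h5 : (2 * M * (1.5 + 2.1 * (p * Real.sqrt N))) * ((3.15 / 4) * Real.sqrt N)
        = 23.625 * (L * Real.sqrt N) + 33.075 * (L * (N * p)) := by
      rw [hM]; linear_combination 33.075 * L * p * hr2
    have h6 : p ^ 2 * N ≤ N * p := by nlinarith [mul_nonneg hNpos.le hp0]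
    have h7 : (gs : ℝ) + 1 ≤ 10 * L * (1.1875 + 4.375 * (N * p)) + 2 * L := by
      have : M * (u1 - 1) ≤ 10 * L * (1.1875 + 4.375 * (N * p)) := by
        rw [hM]
        apply mul_le_mul_of_nonneg_left _ (by linarith)
        rw [hu1, hu0]; linarith
      linarith
    have h8 : L * 10 ≤ L * Real.sqrt N := mul_le_mul_of_nonneg_left hr10 (by linarith)
    have h9 : 0 ≤ L * (N * p) := by positivity
    nlinarith
  · set q : ℕ → ℝ := fun g => (1 - p) ^ (k g) *
            Real.sin ((2 * (k g : ℝ) + 1) * Real.arcsin (1 / Real.sqrt N)) ^ 2 with hq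
    have hq0 : ∀ g, 0 ≤ q g := fun g =>
      mul_nonneg (pow_nonneg (by linarith) _) (sq_nonneg _)
    have hq1 : ∀ g, q g ≤ 1 := fun g =>
      mul_le_one₀ (pow_le_one₀ (by linarith) (by linarith)) (sq_nonneg _) (Real.sin_sq_le_one _)
    have hqlow : ∀ g ∈ Finset.Ico A (gs + 1), 9 / 32 / u1 ≤ q g := by
      intro g hg
      rw [Finset.mem_Ico] at hg
      have hg1 : (A : ℝ) ≤ g := by exact_mod_cast hg.1
      have hg2 : (g : ℝ) ≤ gs := by exact_mod_cast Nat.lt_succ_iff.mp hg.2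
      have hlo : u0 ≤ 1 + (g : ℝ) / M := by
        have : u0 - 1 ≤ (g : ℝ) / M := by rw [le_div_iff₀ hM0]; linarith
        linarith
      have hhi : 1 + (g : ℝ) / M ≤ u1 := by
        have : (g : ℝ) / M ≤ u1 - 1 := by rw [div_le_iff₀ hM0]; linarith
        linarith
      refine le_trans ?_ (aux_q N hN p hp0 hp1 (1 + (g : ℝ) / M) (by linarith) (by linarith)
        (k g) (hk g))
      exact div_le_div_of_nonneg_left (by norm_num) (by linarith) hhi
    have hAgs : A ≤ gs + 1 := by
      have : (A : ℝ) < ((gs + 1 + 1 : ℕ) : ℝ) := by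
        push_cast
        nlinarith
      exact Nat.lt_succ_iff.mp (by exact_mod_cast this)
    have hsumq : L ≤ ∑ g ∈ Finset.range (gs + 1), q g := by
      calc L ≤ ((gs + 1 : ℕ) - (A : ℝ)) * (9 / 32 / u1) := by
            rw [← mul_div_assoc, le_div_iff₀ (by linarith)]
            push_cast
            have : M * (u1 - u0) - 1 ≤ gs + 1 - (A : ℝ) := by linarith
            have hMu : 6.93 * (5 / 4) ≤ M * u0 := by gcongr
            have e1 : L * u1 = 7 / 40 * (M * u0) := by rw [hu1, hM]; ring
            have e2 : M * (u1 - u0) = 3 / 4 * (M * u0) := by rw [hu1]; ring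
            rw [e2] at this
            rw [e1]
            norm_num at hMu
            linarith
        _ = ∑ g ∈ Finset.Ico A (gs + 1), (9 / 32 / u1) := by
            rw [Finset.sum_const, Nat.card_Ico, nsmul_eq_mul, Nat.cast_sub hAgs]
        _ ≤ ∑ g ∈ Finset.Ico A (gs + 1), q g := Finset.sum_le_sum hqlow
        _ ≤ _ := Finset.sum_le_sum_of_subset_of_nonneg
            (fun g hg => Finset.mem_range.mpr (Finset.mem_Ico.mp hg).2) (fun g _ _ => hq0 g)
    calc ∏ g ∈ Finset.range (gs + 1), (1 - q g)
        ≤ ∏ g ∈ Finset.range (gs + 1), Real.exp (-q g) :=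
          Finset.prod_le_prod (fun g _ => by linarith [hq1 g])
            (fun g _ => Real.one_sub_le_exp_neg _)
      _ = Real.exp (-∑ g ∈ Finset.range (gs + 1), q g) := by
          rw [← Real.exp_sum, Finset.sum_neg_distrib]
      _ ≤ Real.exp (-L) := Real.exp_le_exp.mpr (by linarith)
      _ = ε := hεL
end

section
/- Let N ≥ 1 be a natural number, ε ∈ (0,1), c > 0, and set L := c·log(1/ε); assume L ≥ 1. For g ∈ ℕ define k_g := ⌊(1 + g/L)^{−1/2}·(π/4)·√N⌋. Then for every G ∈ ℕ: ∑_{g=0}^{G} (k_g + 1) ≤ G + 1 + (π/4)·√N + (π/2)·√N·L·√(1 + G/L). -/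
/-- Inequality (36) in Appendix C: bound on the total number of oracle calls
of Algorithm 1 after G+1 rounds. -/
theorem stmt13 (N : ℕ) (hN : 1 ≤ N) (ε c : ℝ) (hε0 : 0 < ε) (hε1 : ε < 1) (hc : 0 < c)
    (hL : 1 ≤ c * Real.log (1 / ε)) (G : ℕ) :
    ∑ g ∈ Finset.range (G + 1),
        ((⌊(Real.sqrt (1 + (g : ℝ) / (c * Real.log (1 / ε))))⁻¹ * (Real.pi / 4) *
            Real.sqrt N⌋₊ : ℝ) + 1)
      ≤ (G : ℝ) + 1 + (Real.pi / 4) * Real.sqrt N +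
          (Real.pi / 2) * Real.sqrt N * (c * Real.log (1 / ε)) *
            Real.sqrt (1 + (G : ℝ) / (c * Real.log (1 / ε))) := by
  generalize c * Real.log (1 / ε) = L at hL
  have hA : 0 ≤ Real.pi / 4 * Real.sqrt N := by positivity
  have hL0 : 0 < L := by linarith
  have hfl : ∀ g : ℕ, ((⌊(Real.sqrt (1 + (g : ℝ) / L))⁻¹ * (Real.pi / 4) *
      Real.sqrt N⌋₊ : ℕ) : ℝ) ≤ (Real.sqrt (1 + (g : ℝ) / L))⁻¹ * (Real.pi / 4 * Real.sqrt N) := by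
    intro g
    rw [← mul_assoc]
    exact Nat.floor_le (by positivity)
  induction G with
  | zero =>
    have h := hfl 0
    have h2 : 0 ≤ Real.pi / 4 * Real.sqrt N * L := by positivity
    simp only [zero_add, Finset.sum_range_one]
    simp only [Nat.cast_zero, zero_div, add_zero, Real.sqrt_one, inv_one, one_mul] at h ⊢
    linarith
  | succ n ih =>
    rw [Finset.sum_range_succ]
    have h := hfl (n + 1)
    have hs : Real.sqrt (1 + (n : ℝ) / L) ^ 2 = 1 + (n : ℝ) / L := Real.sq_sqrt (by positivity)
    have ht : Real.sqrt (1 + ((n + 1 : ℕ) : ℝ) / L) ^ 2 = 1 + ((n + 1 : ℕ) : ℝ) / L :=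
      Real.sq_sqrt (by positivity)
    have ht0 : 0 < Real.sqrt (1 + ((n + 1 : ℕ) : ℝ) / L) := Real.sqrt_pos.2 (by positivity)
    generalize Real.sqrt (1 + ((n + 1 : ℕ) : ℝ) / L) = t at *
    generalize Real.sqrt (1 + (n : ℝ) / L) = s at *
    have hd : L * (t ^ 2 - s ^ 2) = 1 := by
      rw [hs, ht]
      push_cast
      field_simp
      ring
    have hk : t⁻¹ ≤ 2 * L * (t - s) := by
      rw [inv_le_iff_one_le_mul₀ ht0]
      nlinarith [mul_nonneg hL0.le (sq_nonneg (t - s))]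
    have hm := mul_le_mul_of_nonneg_right hk hA
    push_cast at h ih ⊢
    linarith
end

section
/- Let N ≥ 100 be a natural number, let ε ∈ (0, 1/2], let p ∈ [0,1], and set c := 10. Define recursively, for g ∈ ℕ with g < N: k_g := ⌊(1 + g/(c·log(1/ε)))^{−1/2}·(π/4)·√(N−g)⌋ if k_0 + k_1 + ⋯ + k_{g−1} + g ≤ (1−ε)·N, and k_g := 0 otherwise; and set s_g := (1−p)^{k_g}·sin²((2k_g+1)·arcsin(1/√(N−g))). Then there exists g* ∈ ℕ with g* < N such that ∑_{g=0}^{g*} (k_g+1) ≤ min{100·(N·p + √N)·log(1/ε), 2·(1−ε)·N + √N} and ∏_{g=0}^{g*} (1 − s_g) ≤ ε. -/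
/-- The inverse square root sum bound. -/
lemma aux_sum_inv_sqrt (C : ℝ) (hC : 1 ≤ C) (n : ℕ) :
    ∑ g ∈ Finset.range (n + 1), (Real.sqrt (1 + (g : ℝ) / C))⁻¹
      ≤ 2 * Real.sqrt C * Real.sqrt (C + n) := by
  have hterm : ∀ g : ℕ, (Real.sqrt (1 + (g : ℝ) / C))⁻¹ ≤
      2 * Real.sqrt C * (Real.sqrt (C + g) - Real.sqrt (C + g - 1)) := by
    intro g
    have hg : (0 : ℝ) ≤ g := Nat.cast_nonneg g
    have h1 : 1 + (g : ℝ) / C = (C + g) / C := by field_simp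
    rw [h1, Real.sqrt_div (by linarith), inv_div]
    have hx : 0 < Real.sqrt (C + g) := Real.sqrt_pos.2 (by linarith)
    have hy : 0 ≤ Real.sqrt (C + g - 1) := Real.sqrt_nonneg _
    have hx2 := Real.sq_sqrt (show 0 ≤ C + (g : ℝ) by linarith)
    have hy2 := Real.sq_sqrt (show 0 ≤ C + (g : ℝ) - 1 by linarith)
    have hs : 0 ≤ Real.sqrt C := Real.sqrt_nonneg _
    rw [div_le_iff₀ hx]
    have : 1 ≤ 2 * (Real.sqrt (C + g) - Real.sqrt (C + g - 1)) * Real.sqrt (C + g) := by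
      nlinarith [sq_nonneg (Real.sqrt (C + g) - Real.sqrt (C + g - 1))]
    nlinarith
  have key : ∀ m : ℕ, ∑ g ∈ Finset.range m, (Real.sqrt (1 + (g : ℝ) / C))⁻¹
      ≤ 2 * Real.sqrt C * (Real.sqrt (C + m - 1) - Real.sqrt (C - 1)) := by
    intro m
    induction m with
    | zero => simp
    | succ m ih =>
      rw [Finset.sum_range_succ]
      have := hterm m
      have e : C + ((m + 1 : ℕ) : ℝ) - 1 = C + m := by push_cast; ring
      rw [e]
      linarith
  have h := key (n + 1)
  have e : C + ((n + 1 : ℕ) : ℝ) - 1 = C + n := by push_cast; ring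
  rw [e] at h
  have := mul_nonneg (mul_nonneg (by norm_num : (0 : ℝ) ≤ 2) (Real.sqrt_nonneg C))
    (Real.sqrt_nonneg (C - 1))
  linarith

/-- arcsin upper bound. -/
lemma aux_arcsin_le (x : ℝ) (hx0 : 0 ≤ x) (hx1 : x ≤ 1) : Real.arcsin x ≤ Real.pi / 2 * x := by
  have h0 : 0 ≤ Real.arcsin x := Real.arcsin_nonneg.2 hx0
  have h := Real.mul_le_sin h0 (Real.arcsin_le_pi_div_two x)
  rw [Real.sin_arcsin (by linarith) hx1] at h
  have hp := Real.pi_pos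
  have : Real.arcsin x = Real.pi / 2 * (2 / Real.pi * Real.arcsin x) := by field_simp
  rw [this]
  exact mul_le_mul_of_nonneg_left h (by positivity)

lemma aux_le_arcsin (x : ℝ) (hx0 : 0 ≤ x) (hx1 : x ≤ 1) : x ≤ Real.arcsin x := by
  have h0 : 0 ≤ Real.arcsin x := Real.arcsin_nonneg.2 hx0
  have h := Real.sin_le h0
  rwa [Real.sin_arcsin (by linarith) hx1] at h

/-- Lower bound of a round with floor effects. -/
lemma aux_round (r M p : ℝ) (k : ℕ) (hM : 40 ≤ M) (hr1 : r ≤ 1 / 2)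
    (hrM : 1 ≤ r * M) (hp0 : 0 ≤ p) (hp1 : p ≤ 1)
    (hk : k = ⌊r * (Real.pi / 4) * M⌋₊) :
    (1 - p * k) * (r - 1 / M * (2 / 3)) ^ 2 ≤
      (1 - p) ^ k * Real.sin ((2 * (k : ℝ) + 1) * Real.arcsin (1 / M)) ^ 2 := by
  have hM0 : 0 < M := by linarith
  have hpi := Real.pi_gt_d2
  have hpi2 := Real.pi_lt_d2
  have hr0 : 0 < r := by
    by_contra h
    nlinarith
  have hk1 : (k : ℝ) ≤ r * (Real.pi / 4) * M := by
    rw [hk]; exact Nat.floor_le (by positivity)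
  have hk2 : r * (Real.pi / 4) * M < k + 1 := by
    rw [hk]; exact Nat.lt_floor_add_one _
  have hx0 : 0 < 1 / M := by positivity
  have hx1 : 1 / M ≤ 1 / 40 := one_div_le_one_div_of_le (by norm_num) hM
  have ha1 := aux_arcsin_le (1 / M) hx0.le (by linarith)
  have ha2 := aux_le_arcsin (1 / M) hx0.le (by linarith)
  set x := 1 / M with hx
  set θ := Real.arcsin x
  have hMx : M * x = 1 := by rw [hx]; field_simp
  set a := (2 * (k : ℝ) + 1) * θ with ha
  have hk0 : (0 : ℝ) ≤ k := Nat.cast_nonneg k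
  have hθ0 : 0 < θ := by linarith
  have ha0 : 0 ≤ a := by positivity
  have hlow : r * (Real.pi / 2) - x ≤ a := by
    have h1 : (2 * (k : ℝ) + 1) * x ≤ a := mul_le_mul_of_nonneg_left ha2 (by positivity)
    have h2 : (r * (Real.pi / 2) * M - 1) * x ≤ (2 * (k : ℝ) + 1) * x :=
      mul_le_mul_of_nonneg_right (by linarith) hx0.le
    have h3 : (r * (Real.pi / 2) * M - 1) * x = r * (Real.pi / 2) - x := by
      linear_combination (r * (Real.pi / 2)) * hMx
    linarith
  have hup : a ≤ Real.pi / 2 := by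
    have h1 : a ≤ (2 * (k : ℝ) + 1) * (Real.pi / 2 * x) :=
      mul_le_mul_of_nonneg_left ha1 (by positivity)
    have h2 : (2 * (k : ℝ) + 1) * x ≤ (r * (Real.pi / 2) * M + 1) * x :=
      mul_le_mul_of_nonneg_right (by linarith) hx0.le
    have h3 : (r * (Real.pi / 2) * M + 1) * x = r * (Real.pi / 2) + x := by
      linear_combination (r * (Real.pi / 2)) * hMx
    have h4 : (2 * (k : ℝ) + 1) * x ≤ 1 := by nlinarith
    nlinarith
  have hsin := Real.mul_le_sin ha0 hup
  have h5 : r - x * (2 / 3) ≤ 2 / Real.pi * a := by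
    have h6 : 2 / Real.pi * (r * (Real.pi / 2) - x) ≤ 2 / Real.pi * a :=
      mul_le_mul_of_nonneg_left hlow (by positivity)
    have h7 : 2 / Real.pi * (r * (Real.pi / 2) - x) = r - x * (2 / Real.pi) := by
      field_simp
    have h8 : 2 / Real.pi ≤ 2 / 3 :=
      div_le_div_of_nonneg_left (by norm_num) (by norm_num) (by linarith)
    nlinarith
  have hpos : 0 ≤ r - x * (2 / 3) := by nlinarith
  have hsq : (r - x * (2 / 3)) ^ 2 ≤ Real.sin a ^ 2 :=
    pow_le_pow_left₀ hpos (h5.trans hsin) 2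
  have hb : 1 - p * k ≤ (1 - p) ^ k := by
    have := one_add_mul_le_pow (show (-2 : ℝ) ≤ -p by linarith) k
    have e : 1 + (-p) = 1 - p := by ring
    rw [e] at this
    linarith
  have hq : 0 ≤ (1 - p) ^ k := pow_nonneg (by linarith) k
  calc (1 - p * k) * (r - x * (2 / 3)) ^ 2 ≤ (1 - p) ^ k * (r - x * (2 / 3)) ^ 2 :=
        mul_le_mul_of_nonneg_right hb (sq_nonneg _)
    _ ≤ _ := mul_le_mul_of_nonneg_left hsq hq

/-- First case: the linear bound. -/
lemma aux_case1 (N : ℕ) (hN : 100 ≤ N) (ε : ℝ) (hε0 : 0 < ε) (hε1 : ε ≤ 1 / 2)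
    (k : ℕ → ℕ) (hk0 : 1 ≤ k 0)
    (hkub : ∀ g : ℕ, g < N → (k g : ℝ) ≤ Real.pi / 4 * Real.sqrt N)
    (hkz : ∀ g : ℕ, g < N → (1 - ε) * N < (∑ j ∈ Finset.range g, (k j : ℝ)) + g → k g = 0)
    (s : ℕ → ℝ) (hs0 : ∀ g : ℕ, g < N → 0 ≤ s g) (hs1 : ∀ g : ℕ, g < N → s g ≤ 1)
    (hsz : ∀ g : ℕ, g < N → k g = 0 → s g = 1 / ((N : ℝ) - g)) :
    ∃ gs : ℕ, gs < N ∧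
      (∑ g ∈ Finset.range (gs + 1), ((k g : ℝ) + 1)) ≤ 2 * (1 - ε) * N + Real.sqrt N ∧
      (∏ g ∈ Finset.range (gs + 1), (1 - s g)) ≤ ε := by
  classical
  have hNR : (100 : ℝ) ≤ N := by exact_mod_cast hN
  have hS10 : (10 : ℝ) ≤ Real.sqrt N := Real.le_sqrt_of_sq_le (by linarith)
  have hpi2 := Real.pi_lt_d2
  let P : ℕ → Prop := fun g => (1 - ε) * N < (∑ j ∈ Finset.range g, (k j : ℝ)) + g
  have hmono : ∀ a b : ℕ, a ≤ b → P a → P b := by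
    intro a b hab ha
    have h1 : (∑ j ∈ Finset.range a, (k j : ℝ)) ≤ ∑ j ∈ Finset.range b, (k j : ℝ) :=
      Finset.sum_le_sum_of_subset_of_nonneg (Finset.range_mono hab)
        (fun _ _ _ => Nat.cast_nonneg _)
    have h2 : (a : ℝ) ≤ b := by exact_mod_cast hab
    simp only [P] at *
    linarith
  have hPN : P (N - 1) := by
    have h1 : (k 0 : ℝ) ≤ ∑ j ∈ Finset.range (N - 1), (k j : ℝ) :=
      Finset.single_le_sum (f := fun j => (k j : ℝ)) (fun _ _ => Nat.cast_nonneg _)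
        (Finset.mem_range.2 (by omega))
    have h2 : (1 : ℝ) ≤ k 0 := by exact_mod_cast hk0
    have h3 : ((N - 1 : ℕ) : ℝ) = N - 1 := by rw [Nat.cast_sub (by omega)]; simp
    simp only [P]
    rw [h3]
    nlinarith
  have hex : ∃ g, P g := ⟨_, hPN⟩
  set G := Nat.find hex with hG
  have hGP : P G := Nat.find_spec hex
  have hGN : G ≤ N - 1 := Nat.find_min' hex hPN
  have hG1 : 1 ≤ G := by
    by_contra h
    have : G = 0 := by omega
    rw [this] at hGP
    simp only [P, Finset.range_zero, Finset.sum_empty, Nat.cast_zero] at hGP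
    nlinarith
  have hGm : ¬ P (G - 1) := Nat.find_min hex (by omega)
  have hcostG : ∑ g ∈ Finset.range G, ((k g : ℝ) + 1) ≤
      (1 - ε) * N + Real.pi / 4 * Real.sqrt N + 1 := by
    obtain ⟨G', hG'⟩ : ∃ G', G = G' + 1 := ⟨G - 1, by omega⟩
    rw [hG'] at hGm ⊢
    simp only [P, not_lt, Nat.add_sub_cancel] at hGm
    rw [Finset.sum_range_succ, Finset.sum_add_distrib]
    have := hkub G' (by omega)
    simp only [Finset.sum_const, Finset.card_range, nsmul_eq_mul, mul_one]
    linarith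
  have hz : ∀ g, G ≤ g → g < N → k g = 0 := fun g h1 h2 => hkz g h2 (hmono G g h1 hGP)
  have hGR : (G : ℝ) + 1 ≤ N := by exact_mod_cast (by omega : G + 1 ≤ N)
  have hGR1 : (1 : ℝ) ≤ G := by exact_mod_cast hG1
  set t := ⌈(1 - ε) * ((N : ℝ) - G)⌉₊ with ht
  have ht1 : (1 - ε) * ((N : ℝ) - G) ≤ t := Nat.le_ceil _
  have ht2 : (t : ℝ) < (1 - ε) * ((N : ℝ) - G) + 1 :=
    Nat.ceil_lt_add_one (by nlinarith)
  have htN : G + t ≤ N := by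
    have : t ≤ N - G := by
      apply Nat.ceil_le.2
      rw [Nat.cast_sub (by omega)]
      nlinarith
    omega
  have hprod : ∀ u : ℕ, G + u ≤ N →
      ∏ i ∈ Finset.range u, (1 - s (G + i)) = ((N : ℝ) - G - u) / ((N : ℝ) - G) := by
    intro u
    induction u with
    | zero =>
      intro _
      have : (N : ℝ) - G ≠ 0 := by linarith
      simp [this]
    | succ u ih =>
      intro hu
      rw [Finset.prod_range_succ, ih (by omega),
        hsz (G + u) (by omega) (hz (G + u) (by omega) (by omega))]
      have h1 : (G : ℝ) + u + 1 ≤ N := by exact_mod_cast hu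
      have h2 : (N : ℝ) - G ≠ 0 := by linarith
      have h3 : (N : ℝ) - (G + u) ≠ 0 := by linarith
      push_cast
      field_simp
      ring
  have e : G + t - 1 + 1 = G + t := by omega
  refine ⟨G + t - 1, by omega, ?_, ?_⟩
  · rw [e, Finset.sum_range_add]
    have h1 : ∑ x ∈ Finset.range t, ((k (G + x) : ℝ) + 1) = t := by
      rw [Finset.sum_congr rfl (g := fun _ => (1 : ℝ))]
      · simp
      · intro x hx
        rw [hz (G + x) (by omega) (by have := Finset.mem_range.1 hx; omega)]
        simp
    rw [h1]
    nlinarith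
  · rw [e, Finset.prod_range_add, hprod t htN]
    have h1 : ∏ x ∈ Finset.range G, (1 - s x) ≤ 1 := by
      apply Finset.prod_le_one
      · intro i hi
        have := hs1 i (by have := Finset.mem_range.1 hi; omega)
        linarith
      · intro i hi
        have := hs0 i (by have := Finset.mem_range.1 hi; omega)
        linarith
    have h2 : ((N : ℝ) - G - t) / ((N : ℝ) - G) ≤ ε := by
      rw [div_le_iff₀ (by linarith)]
      linarith
    have h3 : 0 ≤ ((N : ℝ) - G - t) / ((N : ℝ) - G) := by
      have : (G : ℝ) + t ≤ N := by exact_mod_cast htN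
      exact div_nonneg (by linarith) (by linarith)
    nlinarith

set_option maxHeartbeats 2000000 in
/-- Second case: the noise-dependent bound. -/
lemma aux_case2 (N : ℕ) (ε L S Q p : ℝ) (hε0 : 0 < ε) (hε1 : ε ≤ 1 / 2)
    (hL : L = Real.log (1 / ε)) (hS : S = Real.sqrt N) (hQ : Q = 1 + p * S)
    (hp0 : 0 ≤ p) (hp1 : p ≤ 1) (hN : 100 ≤ N)
    (hlt : 100 * (S * Q) * L < 2 * (1 - ε) * N + S)
    (k : ℕ → ℕ)
    (hkub : ∀ g : ℕ, g < N → (k g : ℝ) ≤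
      (Real.sqrt (1 + (g : ℝ) / (10 * L)))⁻¹ * (Real.pi / 4) * S)
    (hkf : ∀ g : ℕ, g < N → (∑ j ∈ Finset.range g, (k j : ℝ)) + g ≤ (1 - ε) * N →
      k g = ⌊(Real.sqrt (1 + (g : ℝ) / (10 * L)))⁻¹ * (Real.pi / 4) *
          Real.sqrt ((N : ℝ) - g)⌋₊)
    (s : ℕ → ℝ) (hs0 : ∀ g : ℕ, g < N → 0 ≤ s g) (hs1 : ∀ g : ℕ, g < N → s g ≤ 1)
    (hs : ∀ g : ℕ, g < N → s g = (1 - p) ^ (k g) *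
      Real.sin ((2 * (k g : ℝ) + 1) * Real.arcsin (1 / Real.sqrt ((N : ℝ) - g))) ^ 2) :
    ∃ gs : ℕ, gs < N ∧
      (∑ g ∈ Finset.range (gs + 1), ((k g : ℝ) + 1)) ≤ 100 * (S * Q) * L ∧
      (∏ g ∈ Finset.range (gs + 1), (1 - s g)) ≤ ε := by
  have hNR : (100 : ℝ) ≤ N := by exact_mod_cast hN
  have hpi := Real.pi_gt_d2
  have hpi2 := Real.pi_lt_d2
  have hS2 : S ^ 2 = N := by rw [hS]; exact Real.sq_sqrt (by linarith)
  have hS10 : 10 ≤ S := by rw [hS]; exact Real.le_sqrt_of_sq_le (by linarith)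
  have hL' : L = - Real.log ε := by rw [hL, one_div, Real.log_inv]
  have hLε : 1 - ε ≤ L := by
    have := Real.log_le_sub_one_of_pos hε0
    linarith
  have hL69 : 0.69 ≤ L := by
    have h1 : Real.log ε ≤ Real.log (1 / 2) := Real.log_le_log hε0 hε1
    rw [one_div, Real.log_inv] at h1
    have := Real.log_two_gt_d9
    linarith
  have hq0 : 0 ≤ p * S := by positivity
  have hQ1 : 1 ≤ Q := by linarith
  -- main consequence
  have hQL : 49 * (Q * L) ≤ (1 - ε) * S := by
    have h1 : 100 * Q * L < 2 * (1 - ε) * S + 1 := by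
      have : S * (100 * Q * L) < S * (2 * (1 - ε) * S + 1) := by
        rw [← hS2] at hlt
        nlinarith
      exact lt_of_mul_lt_mul_left this (by linarith)
    have h2 : 0.69 ≤ Q * L := by nlinarith
    linarith
  have hQS : 49 * Q ≤ S := by
    have h1 : (1 - ε) * S ≤ L * S := mul_le_mul_of_nonneg_right hLε (by linarith)
    have h2 : L * (49 * Q) ≤ L * S := by linarith
    exact le_of_mul_le_mul_left h2 (by linarith)
  set C := 10 * L with hC
  have hC0 : 0 < C := by linarith
  have hC1 : 6.9 ≤ C := by linarith
  have hQ2 : 1 ≤ Q ^ 2 := by nlinarith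
  have hLQ2 : L * Q ^ 2 ≤ S ^ 2 / 2401 := by
    have h1 : (1 - ε) * S ≤ S := by nlinarith
    have h2 : 49 * (Q * L) * (49 * Q) ≤ S * S :=
      mul_le_mul (hQL.trans h1) hQS (by linarith) (by linarith)
    nlinarith
  have hLQ2' : L * Q ^ 2 ≤ S * Q * L / 49 := by
    have h1 : 49 * Q * (Q * L) ≤ S * (Q * L) :=
      mul_le_mul_of_nonneg_right hQS (by positivity)
    nlinarith
  set n := ⌊C * (6.25 * Q ^ 2 - 1)⌋₊ with hn
  have hn1 : (n : ℝ) ≤ C * (6.25 * Q ^ 2 - 1) := Nat.floor_le (by nlinarith)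
  have hn2 : C * (6.25 * Q ^ 2 - 1) < n + 1 := Nat.lt_floor_add_one _
  have hnS : (n : ℝ) ≤ 0.0261 * S ^ 2 - C := by nlinarith
  have hnN : n < N := by
    have : (n : ℝ) < N := by rw [← hS2]; nlinarith
    exact_mod_cast this
  -- cost bound
  have hcost : ∑ g ∈ Finset.range (n + 1), ((k g : ℝ) + 1) ≤ 41 * (S * Q * L) := by
    have h1 : ∑ g ∈ Finset.range (n + 1), ((k g : ℝ) + 1) ≤
        ∑ g ∈ Finset.range (n + 1),
          ((Real.sqrt (1 + (g : ℝ) / C))⁻¹ * (Real.pi / 4 * S) + 1) := by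
      apply Finset.sum_le_sum
      intro g hg
      have := hkub g (by have := Finset.mem_range.1 hg; omega)
      linarith
    refine h1.trans ?_
    clear h1
    rw [Finset.sum_add_distrib, ← Finset.sum_mul]
    simp only [Finset.sum_const, Finset.card_range, nsmul_eq_mul, mul_one]
    push_cast
    have h2 := aux_sum_inv_sqrt C (by linarith) n
    have h3 : Real.sqrt (C + n) ≤ Real.sqrt C * (2.5 * Q) := by
      have : Real.sqrt C * (2.5 * Q) = Real.sqrt (C * (2.5 * Q) ^ 2) := by
        rw [Real.sqrt_mul hC0.le, Real.sqrt_sq (by linarith)]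
      rw [this]
      apply Real.sqrt_le_sqrt
      nlinarith
    have h4 : 2 * Real.sqrt C * Real.sqrt (C + n) ≤ 50 * L * Q := by
      have h5 : 2 * Real.sqrt C * Real.sqrt (C + n) ≤
          2 * Real.sqrt C * (Real.sqrt C * (2.5 * Q)) :=
        mul_le_mul_of_nonneg_left h3 (by positivity)
      have h6 : 2 * Real.sqrt C * (Real.sqrt C * (2.5 * Q)) = 50 * L * Q := by
        have := Real.mul_self_sqrt hC0.le
        rw [hC] at this ⊢
        linear_combination (5 * Q) * this
      linarith
    have h7 := mul_le_mul_of_nonneg_right (h2.trans h4)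
      (show 0 ≤ Real.pi / 4 * S by positivity)
    have h8 : 50 * L * Q * (Real.pi / 4 * S) ≤ 39.5 * (S * Q * L) := by
      have : 0 ≤ S * Q * L := by positivity
      nlinarith
    have h9 : (n : ℝ) + 1 ≤ 62.5 * (L * Q ^ 2) := by nlinarith
    have : 0 ≤ S * Q * L := by positivity
    linarith
  have hSQL : 0 ≤ S * Q * L := by positivity
  have hcond : ∀ g ≤ n, (∑ j ∈ Finset.range g, (k j : ℝ)) + g ≤ (1 - ε) * N := by
    intro g hg
    have h1 : ∑ j ∈ Finset.range g, ((k j : ℝ) + 1) ≤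
        ∑ g ∈ Finset.range (n + 1), ((k g : ℝ) + 1) :=
      Finset.sum_le_sum_of_subset_of_nonneg (Finset.range_mono (by omega))
        (fun _ _ _ => by positivity)
    rw [Finset.sum_add_distrib] at h1
    simp only [Finset.sum_const, Finset.card_range, nsmul_eq_mul, mul_one] at h1
    have h2 : S * (49 * (Q * L)) ≤ S * ((1 - ε) * S) :=
      mul_le_mul_of_nonneg_left hQL (by linarith)
    have h3 : (1 - ε) * (N : ℝ) = S * ((1 - ε) * S) := by rw [← hS2]; ring
    rw [h3]
    linarith
  set a := ⌈C * (4 * Q ^ 2 - 1)⌉₊ with ha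
  have ha1 : C * (4 * Q ^ 2 - 1) ≤ a := Nat.le_ceil _
  have ha2 : (a : ℝ) < C * (4 * Q ^ 2 - 1) + 1 := Nat.ceil_lt_add_one (by nlinarith)
  have hsw : ∀ g : ℕ, a ≤ g → g ≤ n → 0.08 / Q ^ 2 ≤ s g := by
    intro g hag hgn
    have hgN : g < N := by omega
    have hagR : (a : ℝ) ≤ g := by exact_mod_cast hag
    have hgnR : (g : ℝ) ≤ n := by exact_mod_cast hgn
    set r := (Real.sqrt (1 + (g : ℝ) / C))⁻¹ with hr
    set M := Real.sqrt ((N : ℝ) - g) with hM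
    have hsq1 : 2 * Q ≤ Real.sqrt (1 + (g : ℝ) / C) := by
      apply Real.le_sqrt_of_sq_le
      have : 4 * Q ^ 2 - 1 ≤ (g : ℝ) / C := by
        rw [le_div_iff₀ hC0]; linarith
      linarith
    have hsq2 : Real.sqrt (1 + (g : ℝ) / C) ≤ 2.5 * Q := by
      rw [Real.sqrt_le_left (by linarith)]
      have : (g : ℝ) / C ≤ 6.25 * Q ^ 2 - 1 := by
        rw [div_le_iff₀ hC0]; linarith
      linarith
    have hr1 : r ≤ 1 / (2 * Q) := by
      rw [hr, one_div]; exact inv_anti₀ (by linarith) hsq1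
    have hr2 : 1 / (2.5 * Q) ≤ r := by
      rw [hr, one_div]; exact inv_anti₀ (by linarith) hsq2
    have hMS : 0.98 * S ≤ M := by
      apply Real.le_sqrt_of_sq_le
      rw [← hS2]
      linarith [sq_nonneg S]
    have hQi : 1 / Q ≤ 1 := by rw [div_le_one (by linarith)]; exact hQ1
    have e1 : 1 / (2 * Q) = 1 / Q / 2 := by field_simp
    have e2 : 1 / (2.5 * Q) = 1 / Q * 0.4 := by field_simp; norm_num
    rw [e1] at hr1
    rw [e2] at hr2
    set y := 1 / Q with hy
    have hy0 : 0 < y := by positivity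
    have hyQ : y * Q = 1 := by rw [hy]; field_simp
    have hMQ : 48 * Q ≤ M := by linarith
    have hM0 : 0 < M := by linarith
    have hyM : 1 / M ≤ y / 48 := by
      rw [div_le_iff₀ hM0]
      have := mul_le_mul_of_nonneg_left hMQ hy0.le
      linarith
    have hrM : 1 ≤ r * M := by
      have : y * 0.4 * (48 * Q) ≤ r * M :=
        mul_le_mul hr2 hMQ (by linarith) (by linarith)
      linarith
    have hR := aux_round r M p (k g) (by linarith) (by linarith) hrM hp0 hp1
      (hkf g hgN (hcond g hgn))
    rw [← hs g hgN] at hR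
    have hpk : p * (k g : ℝ) ≤ 0.4 := by
      have h1 := hkub g hgN
      have h2 : p * (k g : ℝ) ≤ p * (r * (Real.pi / 4) * S) :=
        mul_le_mul_of_nonneg_left h1 hp0
      have h3 : p * (r * (Real.pi / 4) * S) = (p * S) * r * (Real.pi / 4) := by ring
      have h4 : (p * S) * r ≤ Q * (y / 2) :=
        mul_le_mul (by linarith) hr1 (by linarith) (by linarith)
      have h4' : (p * S) * r ≤ 1 / 2 := by linarith
      have h4b : (p * S) * r * (Real.pi / 4) ≤ 1 / 2 * (Real.pi / 4) :=
        mul_le_mul_of_nonneg_right h4' (by linarith)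
      linarith
    have h5 : 0.38 * y ≤ r - 1 / M * (2 / 3) := by linarith
    have h6 : (0.38 * y) ^ 2 ≤ (r - 1 / M * (2 / 3)) ^ 2 :=
      pow_le_pow_left₀ (by positivity) h5 2
    have h7 : 0.6 * (0.38 * y) ^ 2 ≤ (1 - p * k g) * (r - 1 / M * (2 / 3)) ^ 2 :=
      mul_le_mul (by linarith) h6 (by positivity) (by linarith)
    have h8 : 0.08 / Q ^ 2 = 0.08 * y ^ 2 := by rw [hy]; field_simp
    rw [h8]
    have h9 : 0.6 * (0.38 * y) ^ 2 = 0.08664 * y ^ 2 := by ring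
    linarith [sq_nonneg y]
  have hsum : L ≤ ∑ g ∈ Finset.range (n + 1), s g := by
    have h1 : ∑ g ∈ Finset.Ico a (n + 1), s g ≤ ∑ g ∈ Finset.range (n + 1), s g := by
      apply Finset.sum_le_sum_of_subset_of_nonneg
      · intro g hg
        exact Finset.mem_range.2 (Finset.mem_Ico.1 hg).2
      · intro g hg _
        exact hs0 g (by have := Finset.mem_range.1 hg; omega)
    have h2 : ∑ g ∈ Finset.Ico a (n + 1), (0.08 / Q ^ 2) ≤ ∑ g ∈ Finset.Ico a (n + 1), s g := by
      apply Finset.sum_le_sum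
      intro g hg
      have := Finset.mem_Ico.1 hg
      exact hsw g this.1 (by omega)
    have hlen : 22.5 * (L * Q ^ 2) - 1 ≤ (n : ℝ) + 1 - a := by nlinarith
    have hLQ : 0.69 ≤ L * Q ^ 2 := by nlinarith
    have han : a ≤ n + 1 := by
      have : (a : ℝ) ≤ ((n + 1 : ℕ) : ℝ) := by push_cast; linarith
      exact_mod_cast this
    rw [Finset.sum_const, Nat.card_Ico, nsmul_eq_mul, Nat.cast_sub han] at h2
    push_cast at h2
    have h3 : L ≤ ((n : ℝ) + 1 - a) * (0.08 / Q ^ 2) := by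
      rw [mul_div_assoc', le_div_iff₀ (by positivity)]
      linarith
    linarith
  refine ⟨n, hnN, by linarith, ?_⟩
  calc ∏ g ∈ Finset.range (n + 1), (1 - s g)
      ≤ ∏ g ∈ Finset.range (n + 1), Real.exp (-s g) := by
        apply Finset.prod_le_prod
        · intro g hg
          have := hs1 g (by have := Finset.mem_range.1 hg; omega)
          linarith
        · intro g _
          have := Real.add_one_le_exp (-s g)
          linarith
    _ = Real.exp (-∑ g ∈ Finset.range (n + 1), s g) := by
        rw [← Real.exp_sum, Finset.sum_neg_distrib]
    _ ≤ Real.exp (Real.log ε) := Real.exp_le_exp.2 (by linarith)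
    _ = ε := Real.exp_log hε0


/-- Analytic content of Theorem 4 (fault-ignorance of the exclusion-based
Algorithm 2). -/
theorem stmt18 (N : ℕ) (hN : 100 ≤ N) (ε : ℝ) (hε0 : 0 < ε) (hε1 : ε ≤ 1 / 2)
    (p : ℝ) (hp0 : 0 ≤ p) (hp1 : p ≤ 1) (c : ℝ) (hc : c = 10)
    (k : ℕ → ℕ)
    (hk : ∀ g : ℕ, g < N → k g =
      if (∑ j ∈ Finset.range g, (k j : ℝ)) + g ≤ (1 - ε) * N then
        ⌊(Real.sqrt (1 + (g : ℝ) / (c * Real.log (1 / ε))))⁻¹ * (Real.pi / 4) *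
          Real.sqrt ((N : ℝ) - g)⌋₊
      else 0)
    (s : ℕ → ℝ)
    (hs : ∀ g : ℕ, g < N → s g = (1 - p) ^ (k g) *
      Real.sin ((2 * (k g : ℝ) + 1) * Real.arcsin (1 / Real.sqrt ((N : ℝ) - g))) ^ 2) :
    ∃ gs : ℕ, gs < N ∧
      (∑ g ∈ Finset.range (gs + 1), ((k g : ℝ) + 1))
          ≤ min (100 * ((N : ℝ) * p + Real.sqrt N) * Real.log (1 / ε))
              (2 * (1 - ε) * N + Real.sqrt N) ∧
      (∏ g ∈ Finset.range (gs + 1), (1 - s g)) ≤ ε := by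
  subst hc
  have hNR : (100 : ℝ) ≤ N := by exact_mod_cast hN
  have hpi := Real.pi_gt_d2
  have hS10 : 10 ≤ Real.sqrt N := Real.le_sqrt_of_sq_le (by linarith)
  have hL0 : 0 < Real.log (1 / ε) := by
    apply Real.log_pos
    rw [lt_div_iff₀ hε0]; linarith
  have hkub : ∀ g : ℕ, g < N → (k g : ℝ) ≤
      (Real.sqrt (1 + (g : ℝ) / (10 * Real.log (1 / ε))))⁻¹ * (Real.pi / 4) * Real.sqrt N := by
    intro g hg
    have hgR : (g : ℝ) ≤ N := by exact_mod_cast hg.le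
    rw [hk g hg]
    split_ifs with h
    · refine (Nat.floor_le (by positivity)).trans ?_
      apply mul_le_mul_of_nonneg_left _ (by positivity)
      apply Real.sqrt_le_sqrt
      linarith [(Nat.cast_nonneg g : (0 : ℝ) ≤ g)]
    · simp only [Nat.cast_zero]; positivity
  have hs0 : ∀ g : ℕ, g < N → 0 ≤ s g := by
    intro g hg
    rw [hs g hg]
    exact mul_nonneg (pow_nonneg (by linarith) _) (sq_nonneg _)
  have hs1 : ∀ g : ℕ, g < N → s g ≤ 1 := by
    intro g hg
    rw [hs g hg]
    exact mul_le_one₀ (pow_le_one₀ (by linarith) (by linarith)) (sq_nonneg _)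
      (Real.sin_sq_le_one _)
  rcases le_or_gt (2 * (1 - ε) * N + Real.sqrt N)
    (100 * ((N : ℝ) * p + Real.sqrt N) * Real.log (1 / ε)) with hcase | hcase
  · rw [min_eq_right hcase]
    apply aux_case1 N hN ε hε0 hε1 k _ _ _ s hs0 hs1
    · intro g hg hz
      rw [hs g hg, hz]
      have hgR : (g : ℝ) + 1 ≤ N := by exact_mod_cast hg
      have h1 : 1 ≤ Real.sqrt ((N : ℝ) - g) := Real.one_le_sqrt.2 (by linarith)
      have h2 : 1 / Real.sqrt ((N : ℝ) - g) ≤ 1 := by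
        rw [div_le_one (by linarith)]; exact h1
      have h3 : 0 ≤ 1 / Real.sqrt ((N : ℝ) - g) := by positivity
      simp only [Nat.cast_zero, mul_zero, zero_add, one_mul, pow_zero]
      rw [Real.sin_arcsin (by linarith) h2, div_pow, Real.sq_sqrt (by linarith), one_pow]
    · rw [hk 0 (by omega), if_pos]
      · apply Nat.le_floor
        simp
        nlinarith
      · simp
        nlinarith
    · intro g hg
      refine (hkub g hg).trans ?_
      apply mul_le_mul_of_nonneg_right _ (by positivity)
      have h1 : (Real.sqrt (1 + (g : ℝ) / (10 * Real.log (1 / ε))))⁻¹ ≤ 1 := by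
        apply inv_le_one_of_one_le₀
        apply Real.one_le_sqrt.2
        have : 0 ≤ (g : ℝ) / (10 * Real.log (1 / ε)) := by positivity
        linarith
      nlinarith
    · intro g hg h
      rw [hk g hg, if_neg (not_le.2 h)]
  · rw [min_eq_left hcase.le]
    have hS2 : Real.sqrt N ^ 2 = N := Real.sq_sqrt (by linarith)
    have e : (N : ℝ) * p + Real.sqrt N = Real.sqrt N * (1 + p * Real.sqrt N) := by
      linear_combination (-p) * hS2
    rw [e] at hcase ⊢
    apply aux_case2 N ε (Real.log (1 / ε)) (Real.sqrt N) (1 + p * Real.sqrt N) p hε0 hε1 rfl rfl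
      rfl hp0 hp1 hN hcase k hkub _ s hs0 hs1 hs
    intro g hg h
    rw [hk g hg, if_pos h]
end
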